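/- arXiv:2005.08297 — 3 statements merged into one kernel-verified Lean document; each statement's English description precedes it below -/
import Mathlib

section
/- Let 0 < α < 1. Then for every real z > 0 one has the two-sided bound 1/(1 + Γ(1−α) z) ≤ E_{α,1}(−z) ≤ 1/(1 + z/Γ(1+α)). -/
/-- The Mittag-Leffler function `E_{α,β}(z) = ∑_{m=0}^∞ z^m / Γ(α m + β)`. -/
noncomputable def mittagLeffler (α β z : ℝ) : ℝ :=
  ∑' m : ℕ, z ^ m / Real.Gamma (α * m + β)

open Set MeasureTheory Filter Topology

lemma ml_gamma_lower {R s : ℝ} (hR : 0 < R) (hs : 1 ≤ s) :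
    Real.exp (-(R + 1)) * R ^ (s - 1) ≤ Real.Gamma s := by
  rw [Real.Gamma_eq_integral (by linarith)]
  have hint := Real.GammaIntegral_convergent (s := s) (by linarith)
  have hsub : Ioc R (R + 1) ⊆ Ioi 0 := fun x hx => lt_trans hR hx.1
  calc Real.exp (-(R + 1)) * R ^ (s - 1)
      = ∫ x in Ioc R (R + 1), Real.exp (-(R + 1)) * R ^ (s - 1) := by simp
    _ ≤ ∫ x in Ioc R (R + 1), Real.exp (-x) * x ^ (s - 1) := by
        refine setIntegral_mono_on (integrableOn_const (by simp)) (hint.mono_set hsub) measurableSet_Ioc ?_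
        intro x hx
        have h1 : Real.exp (-(R + 1)) ≤ Real.exp (-x) := Real.exp_le_exp.2 (by linarith [hx.2])
        have h2 : R ^ (s - 1) ≤ x ^ (s - 1) :=
          Real.rpow_le_rpow hR.le hx.1.le (by linarith)
        exact mul_le_mul h1 h2 (by positivity) (by positivity)
    _ ≤ ∫ x in Ioi 0, Real.exp (-x) * x ^ (s - 1) := by
        refine setIntegral_mono_set hint ?_ hsub.eventuallyLE
        refine (ae_restrict_iff' measurableSet_Ioi).2 (ae_of_all _ ?_)
        intro x hx
        have : (0 : ℝ) < x := hx
        simp only [Pi.zero_apply]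
        positivity

lemma ml_summable {α β : ℝ} (hα : 0 < α) (hβ : 0 < β) (z : ℝ) :
    Summable (fun m : ℕ => z ^ m / Real.Gamma (α * m + β)) := by
  set Q : ℝ := 2 * (|z| + 1) with hQ
  have hQ0 : 0 < Q := by positivity
  set R : ℝ := Q ^ (1 / α) with hRdef
  have hR : 0 < R := by positivity
  set C : ℝ := Real.exp (R + 1) * R ^ (1 - β) with hC
  have hgeo : Summable (fun m : ℕ => C * (1 / 2 : ℝ) ^ m) :=
    (summable_geometric_of_lt_one (by norm_num) (by norm_num)).mul_left C
  refine Summable.of_norm_bounded_eventually_nat hgeo ?_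
  obtain ⟨N, hN⟩ := exists_nat_ge (1 / α)
  filter_upwards [eventually_ge_atTop N] with m hm
  have hm1 : 1 ≤ α * m + β := by
    have : 1 / α ≤ m := hN.trans (by exact_mod_cast hm)
    rw [div_le_iff₀ hα] at this
    linarith
  have hG := ml_gamma_lower hR hm1
  have hpos : 0 < Real.exp (-(R + 1)) * R ^ (α * m + β - 1) := by positivity
  have hRm : R ^ (α * m + β - 1) = Q ^ m * R ^ (β - 1) := by
    rw [add_sub_assoc, Real.rpow_add hR, hRdef, ← Real.rpow_mul hQ0.le,
      show 1 / α * (α * m) = m by field_simp, Real.rpow_natCast]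
  rw [norm_div, norm_pow, Real.norm_eq_abs, Real.norm_of_nonneg (hpos.le.trans hG)]
  calc |z| ^ m / Real.Gamma (α * m + β)
      ≤ (Q / 2) ^ m / (Real.exp (-(R + 1)) * R ^ (α * m + β - 1)) := by
        gcongr
        rw [hQ]; linarith
    _ = C * (1 / 2 : ℝ) ^ m := by
        rw [hRm, hC, Real.exp_neg, show (1 - β) = -(β - 1) by ring, Real.rpow_neg hR.le, div_pow]
        field_simp
        rw [← mul_pow]; norm_num

lemma ml_continuous {α β : ℝ} (hα : 0 < α) (hβ : 0 < β) :
    Continuous (mittagLeffler α β) := by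
  rw [continuous_iff_continuousAt]
  intro z
  have h : ContinuousOn (mittagLeffler α β) (Icc (-(|z| + 1)) (|z| + 1)) := by
    unfold mittagLeffler
    refine continuousOn_tsum (fun m => by fun_prop) (ml_summable hα hβ (|z| + 1)) ?_
    intro m x hx
    have : 0 < Real.Gamma (α * m + β) := Real.Gamma_pos_of_pos (by positivity)
    rw [norm_div, norm_pow, Real.norm_eq_abs, Real.norm_of_nonneg this.le]
    gcongr
    exact abs_le.2 hx
  refine h.continuousAt (Icc_mem_nhds ?_ ?_)
  · linarith [neg_abs_le z]
  · linarith [le_abs_self z]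

lemma ml_rec {α β : ℝ} (hα : 0 < α) (hβ : 0 < β) (z : ℝ) :
    mittagLeffler α β z = 1 / Real.Gamma β + z * mittagLeffler α (β + α) z := by
  unfold mittagLeffler
  rw [(ml_summable hα hβ z).tsum_eq_zero_add, ← tsum_mul_left]
  congr 1
  · simp
  · refine tsum_congr fun m => ?_
    rw [pow_succ, show α * ((m + 1 : ℕ) : ℝ) + β = α * m + (β + α) by push_cast; ring]
    ring

lemma ml_beta {a b t : ℝ} (ha : 0 < a) (hb : 0 < b) (ht : 0 < t) :
    ∫ x in (0:ℝ)..t, x ^ (a - 1) * (t - x) ^ (b - 1) =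
      t ^ (a + b - 1) * (Real.Gamma a * Real.Gamma b / Real.Gamma (a + b)) := by
  have h := Complex.betaIntegral_scaled (a : ℂ) (b : ℂ) ht
  rw [Complex.betaIntegral_eq_Gamma_mul_div _ _ (by simpa) (by simpa)] at h
  have h2 : ∫ x in (0:ℝ)..t, (x : ℂ) ^ ((a : ℂ) - 1) * ((t : ℂ) - x) ^ ((b : ℂ) - 1) =
      ∫ x in (0:ℝ)..t, ((x ^ (a - 1) * (t - x) ^ (b - 1) : ℝ) : ℂ) := by
    refine intervalIntegral.integral_congr fun x hx => ?_
    rw [uIcc_of_le ht.le] at hx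
    rw [Complex.ofReal_mul, Complex.ofReal_cpow hx.1, Complex.ofReal_cpow (by linarith [hx.2])]
    push_cast
    rfl
  rw [h2, intervalIntegral.integral_ofReal, ← Complex.ofReal_add a b, Complex.Gamma_ofReal,
    Complex.Gamma_ofReal, Complex.Gamma_ofReal, ← Complex.ofReal_one, ← Complex.ofReal_sub,
    ← Complex.ofReal_cpow ht.le] at h
  exact_mod_cast h

lemma ml_beta_int {a b t : ℝ} (ha : 0 < a) (hb : 0 < b) (ht : 0 < t) :
    IntervalIntegrable (fun x => x ^ (a - 1) * (t - x) ^ (b - 1)) volume 0 t := by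
  by_contra hcon
  have h := ml_beta ha hb ht
  rw [intervalIntegral.integral_undef hcon] at h
  have h1 := Real.Gamma_pos_of_pos ha
  have h2 := Real.Gamma_pos_of_pos hb
  have h3 := Real.Gamma_pos_of_pos (add_pos ha hb)
  have : 0 < t ^ (a + b - 1) * (Real.Gamma a * Real.Gamma b / Real.Gamma (a + b)) := by positivity
  linarith

/-- `t ^ (β - 1) * E_{α,β}(-t^α)`. -/
noncomputable def mlF (α β t : ℝ) : ℝ := t ^ (β - 1) * mittagLeffler α β (-t ^ α)

lemma mlF_continuousOn {α β : ℝ} (hα : 0 < α) (hβ : 0 < β) : ContinuousOn (mlF α β) (Ioi 0) := by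
  intro x hx
  have hx0 : (0 : ℝ) < x := hx
  refine ContinuousAt.continuousWithinAt ?_
  unfold mlF
  refine (Real.continuousAt_rpow_const _ _ (Or.inl hx0.ne')).mul ?_
  exact (ml_continuous hα hβ).continuousAt.comp
    (Real.continuousAt_rpow_const _ _ (Or.inl hx0.ne')).neg

lemma mlF_conv_int {α β γ t : ℝ} (hα : 0 < α) (hβ : 0 < β) (hγ : 0 < γ) (ht : 0 < t) :
    IntervalIntegrable (fun x => (t - x) ^ (γ - 1) * mlF α β x) volume 0 t := by
  obtain ⟨C, hC⟩ := (isCompact_Icc (a := -t ^ α) (b := 0)).exists_bound_of_continuousOn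
    (ml_continuous hα hβ).continuousOn
  have hmeas : Measurable (fun x => (t - x) ^ (γ - 1) * mlF α β x) := by
    have := (ml_continuous hα hβ).measurable
    unfold mlF
    fun_prop
  have hb := (ml_beta_int hβ hγ ht).mul_const C
  refine hb.mono_fun hmeas.aestronglyMeasurable ?_
  refine (ae_restrict_iff' measurableSet_uIoc).2 (ae_of_all _ ?_)
  intro x hx
  rw [uIoc_of_le ht.le] at hx
  have hxa : x ^ α ≤ t ^ α := Real.rpow_le_rpow hx.1.le hx.2 hα.le
  have hxb : 0 ≤ x ^ α := Real.rpow_nonneg hx.1.le _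
  have h1 := hC (-x ^ α) ⟨by linarith, by linarith⟩
  have h2 : ‖mittagLeffler α β (-x ^ α)‖ ≤ ‖C‖ := h1.trans (le_abs_self C)
  simp only [mlF, norm_mul]
  calc _ = ‖x ^ (β - 1)‖ * ‖(t - x) ^ (γ - 1)‖ * ‖mittagLeffler α β (-x ^ α)‖ := by ring
    _ ≤ _ := by gcongr

lemma mlF_conv {α β γ t : ℝ} (hα : 0 < α) (hβ : 0 < β) (hγ : 0 < γ) (ht : 0 < t) :
    ∫ x in (0:ℝ)..t, (t - x) ^ (γ - 1) * mlF α β x = Real.Gamma γ * mlF α (β + γ) t := by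
  set G : ℕ → ℝ → ℝ := fun m x => x ^ ((α * m + β) - 1) * (t - x) ^ (γ - 1) with hGdef
  set F : ℕ → ℝ → ℝ := fun m x => ((-1) ^ m / Real.Gamma (α * m + β)) * G m x with hFdef
  have hpos : ∀ m : ℕ, 0 < α * m + β := fun m => by positivity
  have hGI : ∀ m, ∫ x in (0:ℝ)..t, G m x = t ^ (β + γ - 1) * (t ^ α) ^ m *
      (Real.Gamma (α * m + β) * Real.Gamma γ / Real.Gamma (α * m + (β + γ))) := by
    intro m
    rw [hGdef]
    simp only
    rw [ml_beta (hpos m) hγ ht, show α * m + β + γ - 1 = (β + γ - 1) + α * m by ring,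
      Real.rpow_add ht, Real.rpow_mul ht.le, Real.rpow_natCast, add_assoc]
  have hFint : ∀ m, IntervalIntegrable (F m) volume 0 t := fun m =>
    (ml_beta_int (hpos m) hγ ht).const_mul _
  have hFint' : ∀ m, Integrable (F m) (volume.restrict (Ioc 0 t)) := fun m =>
    (intervalIntegrable_iff_integrableOn_Ioc_of_le ht.le).1 (hFint m)
  have hFI : ∀ m, ∫ x in Ioc 0 t, F m x = Real.Gamma γ * (t ^ (β + γ - 1) *
      ((-t ^ α) ^ m / Real.Gamma (α * m + (β + γ)))) := by
    intro m
    rw [← intervalIntegral.integral_of_le ht.le, hFdef]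
    simp only
    rw [intervalIntegral.integral_const_mul, hGI, neg_pow (t ^ α)]
    have := (Real.Gamma_pos_of_pos (hpos m)).ne'
    field_simp
  have hFN : ∀ m, ∫ x in Ioc 0 t, ‖F m x‖ = Real.Gamma γ * (t ^ (β + γ - 1) *
      ((t ^ α) ^ m / Real.Gamma (α * m + (β + γ)))) := by
    intro m
    have hg := Real.Gamma_pos_of_pos (hpos m)
    have : ∫ x in Ioc 0 t, ‖F m x‖ = ∫ x in Ioc 0 t, (1 / Real.Gamma (α * m + β)) * G m x := by
      refine setIntegral_congr_fun measurableSet_Ioc fun x hx => ?_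
      have h1 : 0 ≤ G m x := mul_nonneg (Real.rpow_nonneg hx.1.le _)
        (Real.rpow_nonneg (by linarith [hx.2]) _)
      simp only [hFdef, norm_mul, norm_div, norm_pow, norm_neg, norm_one, one_pow]
      rw [Real.norm_of_nonneg h1, Real.norm_of_nonneg hg.le]
    rw [this, ← intervalIntegral.integral_of_le ht.le, intervalIntegral.integral_const_mul, hGI]
    field_simp
  have hs : Summable fun m => ∫ x in Ioc 0 t, ‖F m x‖ := by
    simp_rw [hFN]
    exact ((ml_summable hα (add_pos hβ hγ) (t ^ α)).mul_left _).mul_left _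
  have key := integral_tsum_of_summable_integral_norm hFint' hs
  simp_rw [hFI] at key
  rw [tsum_mul_left, tsum_mul_left] at key
  rw [intervalIntegral.integral_of_le ht.le]
  unfold mlF mittagLeffler
  rw [key]
  refine setIntegral_congr_fun measurableSet_Ioc fun x hx => ?_
  rw [← tsum_mul_left, ← tsum_mul_left]
  refine tsum_congr fun m => ?_
  simp only [hFdef, hGdef]
  rw [add_sub_assoc, Real.rpow_add hx.1, Real.rpow_mul hx.1.le, Real.rpow_natCast,
    neg_pow (x ^ α)]
  ring


lemma mlF_rec {α β t : ℝ} (hα : 0 < α) (hβ : 0 < β) (ht : 0 < t) :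
    mlF α β t = t ^ (β - 1) / Real.Gamma β - mlF α (β + α) t := by
  unfold mlF
  rw [ml_rec hα hβ, show β + α - 1 = (β - 1) + α by ring, Real.rpow_add ht]
  ring

lemma mlF_pos {α : ℝ} (hα : 0 < α) (hα1 : α < 1) {t : ℝ} (ht : 0 < t) : 0 < mlF α α t := by
  have hGα := Real.Gamma_pos_of_pos hα
  by_contra hcon
  push Not at hcon
  set e : ℝ → ℝ := fun x => mittagLeffler α α (-x ^ α) with he
  have hec : Continuous e :=
    (ml_continuous hα hα).comp (Real.continuous_rpow_const hα.le).neg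
  have hfe : ∀ x, mlF α α x = x ^ (α - 1) * e x := fun x => rfl
  have he0 : 0 < e 0 := by
    simp only [he]
    rw [Real.zero_rpow hα.ne', neg_zero, ml_rec hα hα]
    simpa using hGα
  set S : Set ℝ := Ici 0 ∩ e ⁻¹' (Iic 0) with hS
  have hScl : IsClosed S := isClosed_Ici.inter (isClosed_Iic.preimage hec)
  have htS : t ∈ S := by
    refine ⟨ht.le, ?_⟩
    rw [hfe] at hcon
    have : 0 < t ^ (α - 1) := by positivity
    exact nonpos_of_mul_nonpos_right hcon this
  have hSb : BddBelow S := ⟨0, fun x hx => hx.1⟩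
  set t0 := sInf S with ht0def
  have ht0S : t0 ∈ S := hScl.csInf_mem ⟨t, htS⟩ hSb
  have ht0 : 0 < t0 := by
    rcases (show (0 : ℝ) ≤ t0 from ht0S.1).lt_or_eq with h | h
    · exact h
    · have := ht0S.2
      rw [← h] at this
      exact absurd he0 (not_lt.2 this)
  have hpos : ∀ x, 0 < x → x < t0 → 0 < mlF α α x := by
    intro x hx hxt
    rw [hfe]
    refine mul_pos (by positivity) ?_
    by_contra hc
    exact absurd (csInf_le hSb (show x ∈ S from ⟨hx.le, not_lt.1 hc⟩)) (not_le.2 hxt)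
  have hr0 : mlF α α t0 ≤ 0 := by
    rw [hfe]
    exact mul_nonpos_of_nonneg_of_nonpos (by positivity) ht0S.2
  set δ : ℝ := (α * Real.Gamma α / 4) ^ (1 / α) with hδdef
  have hδ : 0 < δ := by positivity
  have hδα : δ ^ α = α * Real.Gamma α / 4 := by
    rw [hδdef, ← Real.rpow_mul (by positivity), one_div_mul_cancel hα.ne', Real.rpow_one]
  set t1 := max (t0 / 2) (t0 - δ) with ht1def
  have ht1a : t0 / 2 ≤ t1 := le_max_left _ _
  have ht1b : t0 - δ ≤ t1 := le_max_right _ _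
  have ht1c : t1 < t0 := max_lt (by linarith) (by linarith)
  obtain ⟨u, hu, hmax⟩ := (isCompact_Icc (a := t1) (b := t0)).exists_isMaxOn
    (nonempty_Icc.2 ht1c.le)
    ((mlF_continuousOn hα hα).mono fun x hx => lt_of_lt_of_le (by linarith) hx.1)
  have hu1 : mlF α α t1 ≤ mlF α α u := hmax ⟨le_rfl, ht1c.le⟩
  have hru : 0 < mlF α α u := (hpos t1 (by linarith) ht1c).trans_le hu1
  have hu0 : 0 < u := by linarith [hu.1]
  have hut : u < t0 := by
    rcases hu.2.lt_or_eq with h | h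
    · exact h
    · rw [h] at hru; linarith
  have eq1 : ∀ x, 0 < x → ∫ y in (0:ℝ)..x, (x - y) ^ (α - 1) * mlF α α y =
      x ^ (α - 1) - Real.Gamma α * mlF α α x := by
    intro x hx
    rw [mlF_conv hα hα hα hx, mlF_rec hα hα hx]
    field_simp
    ring
  have hI0 := mlF_conv_int hα hα hα ht0
  have hIu := mlF_conv_int hα hα hα hu0
  have hIa : IntervalIntegrable (fun x => (t0 - x) ^ (α - 1) * mlF α α x) volume 0 u :=
    hI0.mono_set (by rw [uIcc_of_le hu0.le, uIcc_of_le ht0.le]; exact Icc_subset_Icc_right hut.le)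
  have hIb : IntervalIntegrable (fun x => (t0 - x) ^ (α - 1) * mlF α α x) volume u t0 :=
    hI0.mono_set (by rw [uIcc_of_le hut.le, uIcc_of_le ht0.le]; exact Icc_subset_Icc_left hu0.le)
  have hsplit := intervalIntegral.integral_add_adjacent_intervals hIa hIb
  set q := (t0 / u) ^ (α - 1) with hq
  have hA : ∫ x in (0:ℝ)..u, (t0 - x) ^ (α - 1) * mlF α α x ≤
      q * (u ^ (α - 1) - Real.Gamma α * mlF α α u) := by
    rw [← eq1 u hu0, ← intervalIntegral.integral_const_mul]
    refine intervalIntegral.integral_mono_on_of_le_Ioo hu0.le hIa (hIu.const_mul _) ?_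
    intro x hx
    have hx' := hpos x hx.1 (hx.2.trans hut)
    have hux : 0 < u - x := by linarith [hx.2]
    rw [← mul_assoc, hq, ← Real.mul_rpow (by positivity) hux.le]
    refine mul_le_mul_of_nonneg_right ?_ hx'.le
    refine Real.rpow_le_rpow_of_nonpos (by positivity) ?_ (by linarith)
    rw [div_mul_eq_mul_div, div_le_iff₀ hu0]
    nlinarith [hx.1]
  have hker : IntervalIntegrable (fun x => (t0 - x) ^ (α - 1)) volume u t0 := by
    have := (intervalIntegral.intervalIntegrable_rpow' (a := 0) (b := t0 - u) (r := α - 1)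
      (by linarith)).comp_sub_left t0
    simpa using this.symm
  have hB : ∫ x in u..t0, (t0 - x) ^ (α - 1) * mlF α α x ≤
      (t0 - u) ^ α / α * mlF α α u := by
    have : ∫ x in u..t0, (t0 - x) ^ (α - 1) = (t0 - u) ^ α / α := by
      rw [intervalIntegral.integral_comp_sub_left (fun x => x ^ (α - 1)) t0,
        integral_rpow (Or.inl (by linarith))]
      simp [Real.zero_rpow hα.ne']
    rw [← this, ← intervalIntegral.integral_mul_const]
    refine intervalIntegral.integral_mono_on_of_le_Ioo hut.le hIb (hker.mul_const _) ?_
    intro x hx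
    have h1 : mlF α α x ≤ mlF α α u := hmax ⟨hu.1.trans hx.1.le, hx.2.le⟩
    exact mul_le_mul_of_nonneg_left h1 (Real.rpow_nonneg (by linarith [hx.2]) _)
  have hqu : q * u ^ (α - 1) = t0 ^ (α - 1) := by
    rw [hq, ← Real.mul_rpow (by positivity) hu0.le, div_mul_cancel₀ _ hu0.ne']
  have hq2 : 1 / 2 ≤ q := by
    have h1 : (2:ℝ) ^ (α - 1) ≤ q := by
      refine Real.rpow_le_rpow_of_nonpos (by positivity) ?_ (by linarith)
      rw [div_le_iff₀ hu0]; linarith [hu.1]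
    have h2 : (2:ℝ) ^ (-1 : ℝ) ≤ 2 ^ (α - 1) :=
      Real.rpow_le_rpow_of_exponent_le (by norm_num) (by linarith)
    rw [Real.rpow_neg_one] at h2
    linarith
  have hsm : (t0 - u) ^ α / α ≤ Real.Gamma α / 4 := by
    rw [div_le_iff₀ hα]
    calc (t0 - u) ^ α ≤ δ ^ α := Real.rpow_le_rpow (by linarith) (by linarith [hu.1]) hα.le
      _ = _ := by rw [hδα]; ring
  have e0 := eq1 t0 ht0
  have hm1 : (t0 - u) ^ α / α * mlF α α u ≤ Real.Gamma α / 4 * mlF α α u :=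
    mul_le_mul_of_nonneg_right hsm hru.le
  have hP : 0 < Real.Gamma α * mlF α α u := mul_pos hGα hru
  have hm2 : 1 / 2 * (Real.Gamma α * mlF α α u) ≤ q * (Real.Gamma α * mlF α α u) :=
    mul_le_mul_of_nonneg_right hq2 hP.le
  have hm3 : Real.Gamma α * mlF α α t0 ≤ 0 := mul_nonpos_of_nonneg_of_nonpos hGα.le hr0
  rw [mul_sub, hqu] at hA
  linarith

lemma mlF_int {α t : ℝ} (hα : 0 < α) (ht : 0 < t) :
    IntervalIntegrable (mlF α α) volume 0 t ∧
      ∫ x in (0:ℝ)..t, mlF α α x = 1 - mlF α 1 t := by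
  have h1 := mlF_conv_int hα hα one_pos ht
  have h2 := mlF_conv hα hα one_pos ht
  have h3 := mlF_rec hα one_pos ht
  simp only [sub_self, Real.rpow_zero, one_mul, Real.Gamma_one, div_one] at h1 h2 h3
  refine ⟨h1, ?_⟩
  rw [h2, h3, add_comm α 1]
  ring

lemma mlF_anti {α s t : ℝ} (hα : 0 < α) (hα1 : α < 1) (hs : 0 < s) (hst : s ≤ t) :
    mlF α 1 t ≤ mlF α 1 s := by
  have ht := hs.trans_le hst
  obtain ⟨i1, e1⟩ := mlF_int hα hs
  obtain ⟨i2, e2⟩ := mlF_int hα ht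
  have i3 : IntervalIntegrable (mlF α α) volume s t := i1.symm.trans i2
  have h := intervalIntegral.integral_add_adjacent_intervals i1 i3
  have : 0 ≤ ∫ x in s..t, mlF α α x :=
    intervalIntegral.integral_nonneg hst fun x hx => (mlF_pos hα hα1 (hs.trans_le hx.1)).le
  linarith

lemma mlF_upper {α t : ℝ} (hα : 0 < α) (hα1 : α < 1) (ht : 0 < t) :
    mlF α 1 t * (1 + t ^ α / Real.Gamma (1 + α)) ≤ 1 := by
  have hGα := Real.Gamma_pos_of_pos hα
  have h1 := mlF_conv hα one_pos hα ht
  have hi := mlF_conv_int hα one_pos hα ht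
  have h3 := mlF_rec hα one_pos ht
  simp only [sub_self, Real.rpow_zero, Real.Gamma_one, div_one] at h3
  have hker : IntervalIntegrable (fun x => (t - x) ^ (α - 1)) volume 0 t := by
    have := (intervalIntegral.intervalIntegrable_rpow' (a := 0) (b := t) (r := α - 1)
      (by linarith)).comp_sub_left t
    simpa using this.symm
  have hk : ∫ x in (0:ℝ)..t, (t - x) ^ (α - 1) = t ^ α / α := by
    rw [intervalIntegral.integral_comp_sub_left (fun x => x ^ (α - 1)) t,
      integral_rpow (Or.inl (by linarith))]
    simp [Real.zero_rpow hα.ne']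
  have h4 : t ^ α / α * mlF α 1 t ≤ Real.Gamma α * mlF α (1 + α) t := by
    rw [← h1, ← hk, ← intervalIntegral.integral_mul_const]
    refine intervalIntegral.integral_mono_on_of_le_Ioo ht.le (hker.mul_const _) hi ?_
    intro x hx
    exact mul_le_mul_of_nonneg_left (mlF_anti hα hα1 hx.1 hx.2.le)
      (Real.rpow_nonneg (by linarith [hx.2]) _)
  have h5 : t ^ α / Real.Gamma (1 + α) * mlF α 1 t ≤ mlF α (1 + α) t := by
    rw [add_comm 1 α, Real.Gamma_add_one hα.ne', add_comm α 1, ← div_div, div_mul_eq_mul_div,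
      div_le_iff₀ hGα]
    linarith
  linarith

lemma mlF_lower {α t : ℝ} (hα : 0 < α) (hα1 : α < 1) (ht : 0 < t) :
    1 ≤ mlF α 1 t * (1 + Real.Gamma (1 - α) * t ^ α) := by
  have h1 := mlF_conv hα hα (sub_pos.2 hα1) ht
  have hi := mlF_conv_int hα hα (sub_pos.2 hα1) ht
  obtain ⟨i1, e1⟩ := mlF_int hα ht
  rw [add_sub_cancel] at h1
  have h2 : t ^ (1 - α - 1) * (1 - mlF α 1 t) ≤ Real.Gamma (1 - α) * mlF α 1 t := by
    rw [← h1, ← e1, ← intervalIntegral.integral_const_mul]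
    refine intervalIntegral.integral_mono_on_of_le_Ioo ht.le (i1.const_mul _) hi ?_
    intro x hx
    refine mul_le_mul_of_nonneg_right ?_ (mlF_pos hα hα1 hx.1).le
    exact Real.rpow_le_rpow_of_nonpos (by linarith [hx.2]) (by linarith [hx.1]) (by linarith)
  rw [show 1 - α - 1 = -α by ring, Real.rpow_neg ht.le, inv_mul_le_iff₀ (by positivity)] at h2
  linarith

theorem mittagLeffler_two_sided_bound (α : ℝ) (hα : 0 < α) (hα1 : α < 1)
    (z : ℝ) (hz : 0 < z) :
    1 / (1 + Real.Gamma (1 - α) * z) ≤ mittagLeffler α 1 (-z) ∧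
      mittagLeffler α 1 (-z) ≤ 1 / (1 + z / Real.Gamma (1 + α)) := by
  have ht : 0 < z ^ (1 / α) := by positivity
  have hzt : (z ^ (1 / α)) ^ α = z := by
    rw [← Real.rpow_mul hz.le, one_div_mul_cancel hα.ne', Real.rpow_one]
  have hl := mlF_lower hα hα1 ht
  have hu := mlF_upper hα hα1 ht
  have hg1 := Real.Gamma_pos_of_pos (sub_pos.2 hα1)
  have hg2 := Real.Gamma_pos_of_pos (show 0 < 1 + α by linarith)
  simp only [mlF, hzt, sub_self, Real.rpow_zero, one_mul] at hl hu
  constructor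
  · rwa [div_le_iff₀ (by positivity)]
  · rwa [le_div_iff₀ (by positivity)]
end

section
/- Let 0 < α < 1, T > 0, κ > 1, K > 0 and c_M > 0. Then there exists a constant M > 0 such that for all real μ ≥ c_M and all real λ with 0 < λ ≤ K μ^κ one has μ^{κ−1} · (1 − E_{α,1}(−(μ/(1+λ)) T^α)) ≥ M. -/
open Filter Topology Finset

/-- The coefficients of `(1 - X)^(-r)`. -/
noncomputable def mlA (r : ℝ) (n : ℕ) : ℝ := ∏ k ∈ range n, ((r + k) / (k + 1))

lemma mlA_succ (r : ℝ) (n : ℕ) : mlA r (n + 1) = mlA r n * ((r + n) / (n + 1)) := by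
  unfold mlA; rw [prod_range_succ]

lemma mlA_zero (r : ℝ) : mlA r 0 = 1 := by simp [mlA]

lemma mlA_choose (r : ℝ) (n : ℕ) : Ring.choose (-r) n = (-1) ^ n * mlA r n := by
  have h : ∀ n : ℕ, (descPochhammer ℝ n).eval (-r) = (n.factorial : ℝ) * ((-1) ^ n * mlA r n) := by
    intro n
    induction n with
    | zero => simp [mlA]
    | succ n ih =>
      rw [descPochhammer_succ_eval, ih, mlA_succ, Nat.factorial_succ]
      have : (n : ℝ) + 1 ≠ 0 := by positivity
      push_cast
      field_simp
      ring
  have h2 := Ring.descPochhammer_eq_factorial_smul_choose (-r) n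
  rw [← Polynomial.eval₂_smulOneHom_eq_smeval, ← Polynomial.eval_map] at h2
  have h3 : Polynomial.map (RingHom.smulOneHom : ℤ →+* ℝ) (descPochhammer ℤ n)
      = descPochhammer ℝ n := descPochhammer_map _ n
  rw [h3, h n, nsmul_eq_mul] at h2
  have : (n.factorial : ℝ) ≠ 0 := by exact_mod_cast n.factorial_ne_zero
  exact (mul_left_cancel₀ this h2).symm

lemma mlA_conv (r s : ℝ) (n : ℕ) :
    ∑ p ∈ antidiagonal n, mlA r p.1 * mlA s p.2 = mlA (r + s) n := by
  have h := Ring.add_choose_eq n (Commute.all (-r) (-s))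
  rw [← neg_add, mlA_choose] at h
  have h1 : ((-1 : ℝ) ^ n) * (-1) ^ n = 1 := by rw [← mul_pow]; simp
  have h2 : mlA (r + s) n = (-1) ^ n * ((-1) ^ n * mlA (r + s) n) := by
    rw [← mul_assoc, h1, one_mul]
  rw [h2, h, mul_sum]
  refine sum_congr rfl fun p hp => ?_
  rw [mlA_choose, mlA_choose]
  have hp' : p.1 + p.2 = n := by simpa using hp
  have : (-1 : ℝ) ^ n * ((-1) ^ p.1 * (-1) ^ p.2) = 1 := by
    rw [← pow_add, hp', h1]
  linear_combination (-(mlA r p.1 * mlA s p.2)) * this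

noncomputable def mlG (r : ℝ) : PowerSeries ℝ := PowerSeries.mk (mlA r)

lemma mlG_add (r s : ℝ) : mlG (r + s) = mlG r * mlG s := by
  ext n
  rw [PowerSeries.coeff_mul]
  simp [mlG, mlA_conv]

lemma mlG_zero : mlG 0 = 1 := by
  ext n
  cases n with
  | zero => simp [mlG, mlA]
  | succ n => simp [mlG, mlA, prod_range_succ', PowerSeries.coeff_one]

lemma mlA_one (n : ℕ) : mlA 1 n = 1 := by
  unfold mlA
  refine prod_eq_one fun k _ => ?_
  rw [add_comm]; exact div_self (by positivity)

lemma mlG_neg_one : mlG (-1) = 1 - PowerSeries.X := by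
  ext n
  match n with
  | 0 => simp [mlG, mlA]
  | 1 => simp [mlG, mlA, PowerSeries.coeff_one]
  | n + 2 =>
    have : mlA (-1) (n + 2) = 0 := by
      unfold mlA
      exact prod_eq_zero (i := 1) (by simp) (by simp)
    simp [mlG, this, PowerSeries.coeff_one, PowerSeries.coeff_X]

lemma mlA_neg_nonpos {α : ℝ} (hα : 0 < α) (hα1 : α < 1) (n : ℕ) : mlA (-α) (n + 1) ≤ 0 := by
  unfold mlA
  rw [prod_range_succ']
  refine mul_nonpos_of_nonneg_of_nonpos (prod_nonneg fun k _ => ?_) ?_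
  · push_cast
    have : (0 : ℝ) ≤ k := by positivity
    exact div_nonneg (by linarith) (by positivity)
  · simp; exact hα.le

lemma mlA_nonneg {r : ℝ} (hr : 0 ≤ r) (n : ℕ) : 0 ≤ mlA r n :=
  prod_nonneg fun k _ => by positivity

/-- Positivity of the resolvent. -/
lemma ml_resolvent_nonneg {α h : ℝ} (hα : 0 < α) (hα1 : α < 1) (hh : 0 < h)
    (E : PowerSeries ℝ) (hE : E * (mlG (-α) + PowerSeries.C h) = PowerSeries.C h) (n : ℕ) :
    0 ≤ PowerSeries.coeff n E := by
  induction n using Nat.strong_induction_on with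
  | _ n ih =>
    have h1 := congrArg (PowerSeries.coeff n) hE
    rw [mul_add, map_add, PowerSeries.coeff_mul_C, PowerSeries.coeff_mul,
      Nat.sum_antidiagonal_eq_sum_range_succ_mk, sum_range_succ] at h1
    simp only [mlG, PowerSeries.coeff_mk, Nat.sub_self, mlA_zero, mul_one] at h1
    have h2 : ∑ k ∈ range n, PowerSeries.coeff k E * mlA (-α) (n - k) ≤ 0 := by
      refine sum_nonpos fun k hk => ?_
      have hk' := mem_range.1 hk
      obtain ⟨j, hj⟩ : ∃ j, n - k = j + 1 := ⟨n - k - 1, by omega⟩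
      rw [hj]
      exact mul_nonpos_of_nonneg_of_nonpos (ih k hk') (mlA_neg_nonpos hα hα1 j)
    have h3 : 0 ≤ PowerSeries.coeff n (PowerSeries.C h) := by
      rw [PowerSeries.coeff_C]; split_ifs <;> linarith
    have h4 : 0 ≤ PowerSeries.coeff n E * (1 + h) := by nlinarith
    exact nonneg_of_mul_nonneg_left h4 (by linarith)

lemma ml_discrete_bound {α h : ℝ} (hα : 0 < α) (hα1 : α < 1) (hh : 0 < h) (c : ℕ → ℝ)
    (hc : ∀ n, c n + h * ∑ p ∈ antidiagonal n, c p.1 * mlA α p.2 = 1) (n : ℕ) :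
    c n * (1 + h * mlA (α + 1) n) ≤ 1 := by
  set F : PowerSeries ℝ := PowerSeries.mk c with hF
  have hV : F * (1 + PowerSeries.C h * mlG α) = mlG 1 := by
    ext n
    rw [mul_add, mul_one, mul_left_comm, map_add, PowerSeries.coeff_C_mul, PowerSeries.coeff_mul]
    simp only [hF, mlG, PowerSeries.coeff_mk, mlA_one]
    exact hc n
  have ha : mlG α * mlG (-α) = 1 := by rw [← mlG_add, add_neg_cancel, mlG_zero]
  have hb : mlG 1 * mlG (-1) = 1 := by rw [← mlG_add, add_neg_cancel, mlG_zero]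
  have hE : (1 - F * (1 - PowerSeries.X)) * (mlG (-α) + PowerSeries.C h) = PowerSeries.C h := by
    rw [← mlG_neg_one]
    linear_combination (-mlG (-1) * mlG (-α)) * hV + (PowerSeries.C h * F * mlG (-1)) * ha
      - mlG (-α) * hb
  have hmono : Antitone c := by
    refine antitone_nat_of_succ_le fun n => ?_
    have := ml_resolvent_nonneg hα hα1 hh _ hE (n + 1)
    rw [mul_sub, mul_one, map_sub, map_sub, PowerSeries.coeff_succ_mul_X] at this
    simp [hF, PowerSeries.coeff_one] at this
    linarith
  have h1 : ∑ p ∈ antidiagonal n, c n * mlA α p.2 ≤ ∑ p ∈ antidiagonal n, c p.1 * mlA α p.2 := by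
    refine sum_le_sum fun p hp => ?_
    have hp' : p.1 + p.2 = n := by simpa using hp
    exact mul_le_mul_of_nonneg_right (hmono (by omega)) (mlA_nonneg hα.le _)
  have h2 : ∑ p ∈ antidiagonal n, mlA α p.2 = mlA (α + 1) n := by
    rw [add_comm, ← mlA_conv]; simp [mlA_one]
  rw [← mul_sum, h2] at h1
  have := hc n
  nlinarith

lemma mlA_le_pow {r : ℝ} (hr : 0 ≤ r) (n : ℕ) : mlA (r + 1) n ≤ (1 + r) ^ n := by
  induction n with
  | zero => simp [mlA]
  | succ n ih =>
    rw [mlA_succ, pow_succ]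
    refine mul_le_mul ih ?_ (by positivity) (by positivity)
    rw [div_le_iff₀ (by positivity)]
    have : 0 ≤ r * n := by positivity
    nlinarith

lemma mlA_le_rpow {r : ℝ} (hr : 0 ≤ r) {K n : ℕ} (hK : 0 < K) (hn : K ≤ n) :
    mlA (r + 1) n ≤ (1 + r) ^ K * ((n : ℝ) / K) ^ r := by
  have hKr : (0 : ℝ) < K := by exact_mod_cast hK
  induction n, hn using Nat.le_induction with
  | base => rw [div_self hKr.ne', Real.one_rpow, mul_one]; exact mlA_le_pow hr K
  | succ n hn ih =>
    have hnr : (0 : ℝ) < n := by exact_mod_cast lt_of_lt_of_le hK hn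
    have h1 : (r + 1 + n) / (n + 1) ≤ (((n : ℝ) + 1) / n) ^ r := by
      rw [Real.rpow_def_of_pos (by positivity)]
      have h2 := Real.one_sub_inv_le_log_of_pos (x := ((n : ℝ) + 1) / n) (by positivity)
      have h3 := Real.add_one_le_exp (Real.log (((n : ℝ) + 1) / n) * r)
      have h4 : (r + 1 + n) / (n + 1) = (1 - (((n : ℝ) + 1) / n)⁻¹) * r + 1 := by
        field_simp; ring
      rw [h4]
      exact le_trans (by nlinarith) h3
    rw [mlA_succ]
    calc _ ≤ ((1 + r) ^ K * ((n : ℝ) / K) ^ r) * (((n : ℝ) + 1) / n) ^ r :=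
          mul_le_mul ih h1 (by positivity) (by positivity)
      _ = _ := by
          rw [mul_assoc, ← Real.mul_rpow (by positivity) (by positivity)]
          congr 2
          push_cast
          field_simp

lemma ml_summable_poly {α q : ℝ} (hα : 0 < α) (hα1 : α < 1) (hq : 0 ≤ q) (hq1 : q < 1) (K : ℕ) :
    Summable fun m : ℕ => (1 + α * m) ^ K * q ^ m := by
  have h := summable_pow_mul_geometric_of_norm_lt_one (R := ℝ) K (r := q)
    (by rwa [Real.norm_of_nonneg hq])
  by_cases hq0 : q = 0
  · subst hq0
    refine summable_of_ne_finset_zero (s := {0}) fun m hm => ?_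
    simp at hm
    simp [hm]
  have h' := ((summable_nat_add_iff 1).2 h).mul_right (q⁻¹)
  refine Summable.of_nonneg_of_le (fun m => by positivity) (fun m => ?_) h'
  have : ((m + 1 : ℕ) : ℝ) ^ K * q ^ (m + 1) * q⁻¹ = (m + 1 : ℝ) ^ K * q ^ m := by
    push_cast; rw [pow_succ]; field_simp
  rw [this]
  have hm : (0 : ℝ) ≤ m := by positivity
  have h1 : 1 + α * m ≤ (m + 1 : ℝ) := by nlinarith
  gcongr

lemma ml_summable_s6 {α h : ℝ} (hα : 0 < α) (hα1 : α < 1) (hh : 0 < h) (hh1 : h < 1) (n : ℕ) :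
    Summable fun m : ℕ => (-h) ^ m * mlA (α * m + 1) n := by
  refine Summable.of_norm_bounded (ml_summable_poly hα hα1 hh.le hh1 n) fun m => ?_
  have hn := mlA_nonneg (r := α * m + 1) (by positivity) n
  rw [norm_mul, norm_pow, norm_neg, Real.norm_of_nonneg hh.le, Real.norm_of_nonneg hn, mul_comm]
  gcongr
  exact mlA_le_pow (by positivity) n

lemma ml_sum_bound {α h : ℝ} (hα : 0 < α) (hα1 : α < 1) (hh : 0 < h) (hh1 : h < 1) (n : ℕ) :
    (∑' m : ℕ, (-h) ^ m * mlA (α * m + 1) n) * (1 + h * mlA (α + 1) n) ≤ 1 := by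
  refine ml_discrete_bound hα hα1 hh (fun n => ∑' m : ℕ, (-h) ^ m * mlA (α * m + 1) n) ?_ n
  intro n
  have hs := ml_summable_s6 hα hα1 hh hh1
  have h1 : ∑ p ∈ antidiagonal n, (∑' m : ℕ, (-h) ^ m * mlA (α * m + 1) p.1) * mlA α p.2
      = ∑' m : ℕ, (-h) ^ m * mlA (α * (m + 1 : ℕ) + 1) n := by
    simp_rw [← tsum_mul_right]
    rw [← Summable.tsum_finsetSum (fun p _ => (hs p.1).mul_right _)]
    refine tsum_congr fun m => ?_
    have : α * ((m + 1 : ℕ) : ℝ) + 1 = (α * m + 1) + α := by push_cast; ring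
    rw [this, ← mlA_conv, mul_sum]
    exact sum_congr rfl fun p _ => by ring
  rw [h1, (hs n).tsum_eq_zero_add, ← tsum_mul_left, add_assoc]
  have h2 : ∀ m : ℕ, h * ((-h) ^ m * mlA (α * (m + 1 : ℕ) + 1) n)
      = -((-h) ^ (m + 1) * mlA (α * (m + 1 : ℕ) + 1) n) := fun m => by ring
  simp_rw [h2]
  rw [tsum_neg, add_neg_cancel]
  simp [mlA_one]

lemma mlA_tendsto {r : ℝ} (hr : 0 ≤ r) :
    Tendsto (fun n : ℕ => mlA (r + 1) n * (n : ℝ) ^ (-r)) atTop (𝓝 (1 / Real.Gamma (r + 1))) := by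
  rcases hr.eq_or_lt with rfl | hr
  · simp [mlA_one]
  have h := (Real.GammaSeq_tendsto_Gamma r).const_mul r
  rw [← Real.Gamma_add_one hr.ne'] at h
  have h2 := h.inv₀ (Real.Gamma_pos_of_pos (by linarith)).ne'
  rw [one_div]
  refine h2.congr' ?_
  filter_upwards [eventually_gt_atTop 0] with n hn
  have hn' : (0 : ℝ) < n := by exact_mod_cast hn
  have h3 : ∀ n : ℕ, ∏ j ∈ range (n + 1), (r + j) = r * mlA (r + 1) n * n.factorial := by
    intro n
    induction n with
    | zero => simp [mlA]
    | succ n ih =>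
      rw [prod_range_succ, ih, mlA_succ, Nat.factorial_succ]
      push_cast
      field_simp
      ring
  have hpos : 0 < mlA (r + 1) n := prod_pos fun k _ => by positivity
  have hf : (n.factorial : ℝ) ≠ 0 := by exact_mod_cast n.factorial_ne_zero
  rw [Real.GammaSeq, h3, Real.rpow_neg hn'.le]
  have : (n : ℝ) ^ r ≠ 0 := by positivity
  field_simp

lemma mittagLeffler_neg_bound {α x : ℝ} (hα : 0 < α) (hα1 : α < 1) (hx : 0 < x) :
    mittagLeffler α 1 (-x) * (1 + x * (1 / Real.Gamma (α + 1))) ≤ 1 := by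
  have hlim0 : Tendsto (fun n : ℕ => x * (n : ℝ) ^ (-α)) atTop (𝓝 0) := by
    simpa using ((tendsto_rpow_neg_atTop hα).comp tendsto_natCast_atTop_atTop).const_mul x
  have hev : ∀ᶠ n : ℕ in atTop, x * (n : ℝ) ^ (-α) < 1 := hlim0.eventually (gt_mem_nhds one_pos)
  obtain ⟨K, hK1, hK0⟩ := (hev.and (eventually_gt_atTop 0)).exists
  have hKr : (0 : ℝ) < K := by exact_mod_cast hK0
  have hsum : Tendsto (fun n : ℕ => ∑' m : ℕ, (-(x * (n : ℝ) ^ (-α))) ^ m * mlA (α * m + 1) n)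
      atTop (𝓝 (mittagLeffler α 1 (-x))) := by
    refine tendsto_tsum_of_dominated_convergence
      (ml_summable_poly hα hα1 (q := x * (K : ℝ) ^ (-α)) (by positivity) hK1 K) ?_ ?_
    · intro m
      have h := (mlA_tendsto (r := α * m) (by positivity)).const_mul ((-x) ^ m)
      rw [mul_one_div] at h
      refine h.congr fun n => ?_
      have : ((n : ℝ) ^ (-α)) ^ m = (n : ℝ) ^ (-(α * m)) := by
        rw [← Real.rpow_natCast, ← Real.rpow_mul (by positivity)]; ring_nf
      rw [← neg_mul x, mul_pow, this]; ring
    · filter_upwards [eventually_ge_atTop K] with n hn m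
      have hnr : (0 : ℝ) < n := by exact_mod_cast lt_of_lt_of_le hK0 hn
      have hnn := mlA_nonneg (r := α * m + 1) (by positivity) n
      rw [norm_mul, norm_pow, norm_neg, Real.norm_of_nonneg hnn,
        Real.norm_of_nonneg (by positivity)]
      have h1 := mlA_le_rpow (r := α * m) (by positivity) hK0 hn
      calc _ ≤ (x * (n : ℝ) ^ (-α)) ^ m * ((1 + α * m) ^ K * ((n : ℝ) / K) ^ (α * m)) := by
            gcongr
        _ = (1 + α * m) ^ K * (x * ((n : ℝ) ^ (-α) * ((n : ℝ) / K) ^ α)) ^ m := by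
            rw [Real.rpow_mul (by positivity), Real.rpow_natCast]; ring
        _ = _ := by
            congr 3
            rw [Real.div_rpow hnr.le hKr.le, Real.rpow_neg hnr.le, Real.rpow_neg hKr.le]
            have : (n : ℝ) ^ α ≠ 0 := by positivity
            field_simp
  have hA : Tendsto (fun n : ℕ => 1 + (x * (n : ℝ) ^ (-α)) * mlA (α + 1) n) atTop
      (𝓝 (1 + x * (1 / Real.Gamma (α + 1)))) := by
    refine (((mlA_tendsto hα.le).const_mul x).const_add 1).congr fun n => ?_
    ring
  refine le_of_tendsto (hsum.mul hA) ?_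
  filter_upwards [hev, eventually_gt_atTop 0] with n hn hn0
  have hnr : (0 : ℝ) < n := by exact_mod_cast hn0
  exact ml_sum_bound hα hα1 (by positivity) hn n

/-- For `0 < α < 1`, `T > 0`, `κ > 1`, `K > 0`, `c_M > 0`, there is `M > 0` such
that for all `μ ≥ c_M` and all `λ` with `0 < λ ≤ K μ^κ` one has
`μ^{κ−1} (1 − E_{α,1}(−(μ/(1+λ)) T^α)) ≥ M`. -/
theorem mittagLeffler_uniform_lower_bound (α T κ K cM : ℝ)
    (hα : 0 < α) (hα1 : α < 1) (hT : 0 < T) (hκ : 1 < κ) (hK : 0 < K) (hcM : 0 < cM) :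
    ∃ M > 0, ∀ μ lam : ℝ, cM ≤ μ → 0 < lam → lam ≤ K * μ ^ κ →
      M ≤ μ ^ (κ - 1) * (1 - mittagLeffler α 1 (-(μ / (1 + lam)) * T ^ α)) := by
  have hG : 0 < 1 / Real.Gamma (α + 1) := by
    have := Real.Gamma_pos_of_pos (s := α + 1) (by linarith)
    positivity
  set b : ℝ := T ^ α * (1 / Real.Gamma (α + 1)) with hb
  have hb0 : 0 < b := by positivity
  have hD : 0 < (cM ^ κ)⁻¹ + K + b * (cM ^ (κ - 1))⁻¹ := by positivity
  refine ⟨b / ((cM ^ κ)⁻¹ + K + b * (cM ^ (κ - 1))⁻¹), by positivity, ?_⟩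
  intro μ lam hμ hl hlK
  have hμ0 : 0 < μ := lt_of_lt_of_le hcM hμ
  have hE := mittagLeffler_neg_bound hα hα1 (x := μ / (1 + lam) * T ^ α) (by positivity)
  rw [← neg_mul, mul_assoc (μ / (1 + lam)), ← hb] at hE
  set E := mittagLeffler α 1 (-(μ / (1 + lam)) * T ^ α)
  have h1 : E ≤ 1 / (1 + μ / (1 + lam) * b) := by
    rw [le_div_iff₀ (by positivity)]; exact hE
  have h2 : μ * b / (1 + lam + μ * b) ≤ 1 - E := by
    have : μ * b / (1 + lam + μ * b) = 1 - 1 / (1 + μ / (1 + lam) * b) := by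
      field_simp; ring
    linarith
  have hp : μ ^ κ = μ ^ (κ - 1) * μ := by
    rw [← Real.rpow_add_one hμ0.ne']; ring_nf
  have h3 : cM ^ κ ≤ μ ^ κ := Real.rpow_le_rpow hcM.le hμ (by linarith)
  have h4 : cM ^ (κ - 1) ≤ μ ^ (κ - 1) := Real.rpow_le_rpow hcM.le hμ (by linarith)
  have h5 : 1 ≤ (cM ^ κ)⁻¹ * μ ^ κ := by
    rw [inv_mul_eq_div, one_le_div (by positivity)]; exact h3
  have h6 : 1 ≤ (cM ^ (κ - 1))⁻¹ * μ ^ (κ - 1) := by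
    rw [inv_mul_eq_div, one_le_div (by positivity)]; exact h4
  refine le_trans ?_ (mul_le_mul_of_nonneg_left h2 (by positivity))
  rw [← mul_div_assoc, div_le_div_iff₀ hD (by positivity)]
  have h7 : 1 + lam + μ * b ≤ μ ^ κ * ((cM ^ κ)⁻¹ + K + b * (cM ^ (κ - 1))⁻¹) := by
    have : μ * b ≤ μ ^ κ * (b * (cM ^ (κ - 1))⁻¹) := by
      have := mul_le_mul_of_nonneg_left h6 (mul_pos hμ0 hb0).le
      rw [hp]; linarith
    linarith
  calc b * (1 + lam + μ * b) ≤ b * (μ ^ κ * ((cM ^ κ)⁻¹ + K + b * (cM ^ (κ - 1))⁻¹)) := by gcongr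
    _ = _ := by rw [hp]; ring
end

section
/- Let 0 < α < 1, λ > 0, μ > 0, T > 0, φ ∈ ℝ, ψ ∈ ℝ; set ν = μ/(1+λ). Then there exists a unique pair of real constants (C, f) such that the function u(t) = f/μ + C · E_{α,1}(−ν t^α) satisfies u(0) = φ and u(T) = ψ; namely C = (φ − ψ) / (1 − E_{α,1}(−ν T^α)) and f = μ φ − μ C (the denominator is nonzero since 0 < E_{α,1}(−ν T^α) < 1). -/
section helpers
open Filter Topology


lemma ml_ratio (α : ℝ) (hα : 0 < α) (hα1 : α < 1) :
    Tendsto (fun n : ℕ ↦ ‖(1 / Real.Gamma (α * (n.succ : ℕ) + 1))‖ / ‖(1 / Real.Gamma (α * n + 1))‖)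
      atTop (𝓝 0) := by
  have key : ∀ y : ℝ, 1 ≤ y → Real.Gamma y / Real.Gamma (y + α) ≤ 2 * y ^ (-α) := by
    intro y hy
    have hy0 : 0 < y := by linarith
    have h := Real.Gamma_mul_add_mul_le_rpow_Gamma_mul_rpow_Gamma (s := y + α) (t := y + α + 1)
      (a := α) (b := 1 - α) (by linarith) (by linarith) hα (by linarith) (by ring)
    have e1 : α * (y + α) + (1 - α) * (y + α + 1) = y + 1 := by ring
    have hG : 0 < Real.Gamma (y + α) := Real.Gamma_pos_of_pos (by linarith)
    rw [e1, Real.Gamma_add_one hy0.ne', Real.Gamma_add_one (by linarith : y + α ≠ 0),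
      Real.mul_rpow (by linarith) hG.le] at h
    have e2 : Real.Gamma (y + α) ^ α * ((y + α) ^ (1 - α) * Real.Gamma (y + α) ^ (1 - α))
        = Real.Gamma (y + α) * (y + α) ^ (1 - α) := by
      rw [mul_left_comm, ← Real.rpow_add hG]
      simp [mul_comm]
    rw [e2] at h
    have h3 : (y + α) ^ (1 - α) ≤ 2 * y ^ (1 - α) := by
      calc (y + α) ^ (1 - α) ≤ (2 * y) ^ (1 - α) :=
            Real.rpow_le_rpow (by linarith) (by linarith) (by linarith)
        _ = 2 ^ (1 - α) * y ^ (1 - α) := Real.mul_rpow (by norm_num) hy0.le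
        _ ≤ 2 ^ (1:ℝ) * y ^ (1 - α) := by
            gcongr
            · norm_num
            · linarith
        _ = _ := by simp
    rw [div_le_iff₀ hG]
    have h4 : y ^ (1 - α) = y * y ^ (-α) := by
      rw [sub_eq_add_neg, Real.rpow_add hy0, Real.rpow_one]
    have h5 : y * Real.Gamma y ≤ y * (2 * y ^ (-α) * Real.Gamma (y + α)) := by
      calc _ ≤ _ := h
        _ ≤ Real.Gamma (y + α) * (2 * y ^ (1 - α)) := by gcongr
        _ = _ := by rw [h4]; ring
    exact le_of_mul_le_mul_left h5 hy0
  have hlim : Tendsto (fun n : ℕ ↦ 2 * (α * n + 1) ^ (-α)) atTop (𝓝 0) := by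
    have h1 : Tendsto (fun n : ℕ ↦ α * (n:ℝ) + 1) atTop atTop :=
      tendsto_atTop_add_const_right _ _ (tendsto_natCast_atTop_atTop.const_mul_atTop hα)
    simpa using ((tendsto_rpow_neg_atTop hα).comp h1).const_mul 2
  refine squeeze_zero (fun n ↦ by positivity) (fun n ↦ ?_) hlim
  have h1 : 0 ≤ α * (n:ℝ) := by positivity
  have hg1 : 0 < Real.Gamma (α * n + 1) := Real.Gamma_pos_of_pos (by linarith)
  have hg2 : 0 < Real.Gamma (α * n + 1 + α) := Real.Gamma_pos_of_pos (by linarith)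
  have := key (α * n + 1) (by linarith)
  have e : α * ((n.succ : ℕ) : ℝ) + 1 = α * n + 1 + α := by push_cast; ring
  rw [e, Real.norm_of_nonneg (by positivity), Real.norm_of_nonneg (by positivity)]
  convert this using 1
  field_simp

lemma ml_hasFP (α : ℝ) (hα : 0 < α) (hα1 : α < 1) :
    (∀ z : ℝ, Summable (fun m : ℕ ↦ z ^ m / Real.Gamma (α * m + 1))) ∧
    Differentiable ℝ (mittagLeffler α 1) := by
  have hc : ∀ n : ℕ, (1 / Real.Gamma (α * n + 1)) ≠ 0 := fun n ↦ by
    have : 0 < Real.Gamma (α * n + 1) := Real.Gamma_pos_of_pos (by positivity)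
    positivity
  have hr := FormalMultilinearSeries.ofScalars_radius_eq_top_of_tendsto ℝ
    (fun n : ℕ ↦ 1 / Real.Gamma (α * n + 1)) (Eventually.of_forall hc) (ml_ratio α hα hα1)
  set p := FormalMultilinearSeries.ofScalars ℝ (fun n : ℕ ↦ 1 / Real.Gamma (α * n + 1)) with hp
  have hfp := p.hasFPowerSeriesOnBall (by rw [hr]; simp)
  rw [hr] at hfp
  have hpe : ∀ (z : ℝ) (n : ℕ), p n (fun _ ↦ z) = z ^ n / Real.Gamma (α * n + 1) := by
    intro z n
    simp [hp, FormalMultilinearSeries.ofScalars, div_eq_mul_inv, mul_comm]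
  have hsum : p.sum = mittagLeffler α 1 := by
    funext z
    simp only [FormalMultilinearSeries.sum, mittagLeffler, hpe]
  constructor
  · intro z
    have := (hfp.hasSum (y := z) (by simp)).summable
    simpa only [hpe] using this
  · rw [← hsum]
    intro z
    exact (hfp.analyticAt_of_mem (y := z) (by simp)).differentiableAt

lemma real_beta (a b t : ℝ) (ha : 0 < a) (hb : 0 < b) (ht : 0 < t) :
    ∫ s in (0:ℝ)..t, s ^ (a - 1) * (t - s) ^ (b - 1) =
      t ^ (a + b - 1) * (Real.Gamma a * Real.Gamma b / Real.Gamma (a + b)) := by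
  have h := Complex.betaIntegral_scaled (a : ℂ) (b : ℂ) ht
  rw [Complex.betaIntegral_eq_Gamma_mul_div _ _ (by simpa) (by simpa)] at h
  have e : ∫ s in (0:ℝ)..t, (s : ℂ) ^ ((a : ℂ) - 1) * ((t : ℂ) - s) ^ ((b : ℂ) - 1) =
      ((∫ s in (0:ℝ)..t, s ^ (a - 1) * (t - s) ^ (b - 1) : ℝ) : ℂ) := by
    rw [← intervalIntegral.integral_ofReal]
    apply intervalIntegral.integral_congr
    intro s hs
    rw [Set.uIcc_of_le ht.le] at hs
    simp only
    rw [Complex.ofReal_mul, Complex.ofReal_cpow hs.1, Complex.ofReal_cpow (by linarith [hs.2])]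
    push_cast
    rfl
  rw [e, ← Complex.ofReal_add, Complex.Gamma_ofReal, Complex.Gamma_ofReal, Complex.Gamma_ofReal,
    ← Complex.ofReal_one, ← Complex.ofReal_sub, ← Complex.ofReal_cpow ht.le] at h
  exact_mod_cast h

lemma kernel_ii (α t a b : ℝ) (hα : 0 < α) {f : ℝ → ℝ} (hf : Continuous f) :
    IntervalIntegrable (fun s ↦ (t - s) ^ (α - 1) * f s) MeasureTheory.volume a b := by
  apply IntervalIntegrable.mul_continuousOn _ hf.continuousOn
  have := (intervalIntegral.intervalIntegrable_rpow' (a := t - a) (b := t - b) (r := α - 1)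
    (by linarith)).comp_sub_left t
  simpa using this

lemma volterra (α ν t : ℝ) (hα : 0 < α) (hα1 : α < 1) (hν : 0 < ν) (ht : 0 < t) :
    mittagLeffler α 1 (-ν * t ^ α) = 1 - ν / Real.Gamma α *
      ∫ s in (0:ℝ)..t, (t - s) ^ (α - 1) * mittagLeffler α 1 (-ν * s ^ α) := by
  obtain ⟨hS, -⟩ := ml_hasFP α hα hα1
  have hcp : Continuous (fun s : ℝ ↦ s ^ α) := Real.continuous_rpow_const hα.le
  have hmain : HasSum (fun n : ℕ ↦ ∫ s in (0:ℝ)..t, (t - s) ^ (α - 1) *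
      ((-ν * s ^ α) ^ n / Real.Gamma (α * n + 1)))
      (∫ s in (0:ℝ)..t, (t - s) ^ (α - 1) * mittagLeffler α 1 (-ν * s ^ α)) := by
    refine intervalIntegral.hasSum_integral_of_dominated_convergence
      (fun n s ↦ (t - s) ^ (α - 1) * ((ν * t ^ α) ^ n / Real.Gamma (α * n + 1))) ?_ ?_ ?_ ?_ ?_
    · intro n
      exact (kernel_ii α t 0 t hα
        (f := fun s ↦ ((-ν * s ^ α) ^ n / Real.Gamma (α * n + 1))) (by fun_prop)).def'.1
    · intro n
      refine Eventually.of_forall fun s hs ↦ ?_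
      rw [Set.uIoc_of_le ht.le] at hs
      have hG : 0 < Real.Gamma (α * n + 1) := Real.Gamma_pos_of_pos (by positivity)
      have h1 : 0 ≤ t - s := by linarith [hs.2]
      have h2 : 0 ≤ s ^ α := Real.rpow_nonneg hs.1.le _
      rw [norm_mul, norm_div, norm_pow, norm_mul, norm_neg, Real.norm_of_nonneg hν.le,
        Real.norm_of_nonneg h2, Real.norm_of_nonneg hG.le,
        Real.norm_of_nonneg (Real.rpow_nonneg h1 _)]
      have h3 : s ^ α ≤ t ^ α := Real.rpow_le_rpow hs.1.le hs.2 hα.le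
      have := Real.rpow_nonneg h1 (α - 1)
      gcongr
    · exact Eventually.of_forall fun s hs ↦ (hS _).mul_left _
    · simp_rw [tsum_mul_left]
      exact kernel_ii α t 0 t hα continuous_const
    · exact Eventually.of_forall fun s hs ↦ ((hS _).hasSum).mul_left _
  have hterm : ∀ n : ℕ, ν / Real.Gamma α * (∫ s in (0:ℝ)..t, (t - s) ^ (α - 1) *
      ((-ν * s ^ α) ^ n / Real.Gamma (α * n + 1))) =
      - ((-ν * t ^ α) ^ (n + 1) / Real.Gamma (α * (n + 1 : ℕ) + 1)) := by
    intro n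
    have hb := real_beta (α * n + 1) α t (by positivity) hα ht
    have e : ∫ s in (0:ℝ)..t, (t - s) ^ (α - 1) * ((-ν * s ^ α) ^ n / Real.Gamma (α * n + 1)) =
        ((-ν) ^ n / Real.Gamma (α * n + 1)) *
          ∫ s in (0:ℝ)..t, s ^ (α * n + 1 - 1) * (t - s) ^ (α - 1) := by
      rw [← intervalIntegral.integral_const_mul]
      apply intervalIntegral.integral_congr
      intro s hs
      rw [Set.uIcc_of_le ht.le] at hs
      simp only
      rw [add_sub_cancel_right, Real.rpow_mul_natCast hs.1, mul_pow]
      ring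
    rw [e, hb]
    have hG : 0 < Real.Gamma (α * n + 1) := Real.Gamma_pos_of_pos (by positivity)
    have hG2 : 0 < Real.Gamma α := Real.Gamma_pos_of_pos hα
    have e1 : α * n + 1 + α = α * (n + 1 : ℕ) + 1 := by push_cast; ring
    have hG3 : 0 < Real.Gamma (α * (n + 1 : ℕ) + 1) := Real.Gamma_pos_of_pos (by positivity)
    rw [e1, add_sub_cancel_right, Real.rpow_mul_natCast ht.le, mul_pow, pow_succ (-ν)]
    field_simp
  have h2 := hmain.mul_left (ν / Real.Gamma α)
  simp_rw [hterm] at h2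
  have h3 := (hS (-ν * t ^ α)).tsum_eq_zero_add
  have h4 := h2.tsum_eq
  rw [tsum_neg] at h4
  rw [← h4]
  unfold mittagLeffler
  rw [h3]
  simp

lemma kernel_diff (α x h M : ℝ) (hα : 0 < α) (hα1 : α < 1) (hx : 0 < x) (hh : 0 < h)
    (hM : x + h ≤ M) :
    (1 - α) * M ^ (α - 2) * h ≤ x ^ (α - 1) - (x + h) ^ (α - 1) := by
  have hy : 0 < x + h := by linarith
  have hb := rpow_one_add_le_one_add_mul_self (s := -(h / (x + h)))
    (by rw [neg_le_neg_iff, div_le_one hy]; linarith) (p := 1 - α) (by linarith) (by linarith)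
  have e : 1 + -(h / (x + h)) = x / (x + h) := by field_simp; ring
  rw [e, Real.div_rpow hx.le hy.le, div_le_iff₀ (by positivity)] at hb
  have ex : x ^ (α - 1) = (x ^ (1 - α))⁻¹ := by rw [← Real.rpow_neg hx.le]; congr 1; ring
  have ey : (x + h) ^ (α - 1) = ((x + h) ^ (1 - α))⁻¹ := by
    rw [← Real.rpow_neg hy.le]; congr 1; ring
  have e3 : (x + h) ^ (α - 2) = (x + h) ^ (α - 1) / (x + h) := by
    rw [show α - 2 = α - 1 - 1 by ring, Real.rpow_sub_one hy.ne']
  have h4 : M ^ (α - 2) ≤ (x + h) ^ (α - 2) :=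
    Real.rpow_le_rpow_of_nonpos hy hM (by linarith)
  have h5 : (1 - α) * M ^ (α - 2) * h ≤ (1 - α) * (x + h) ^ (α - 2) * h := by
    have : 0 ≤ 1 - α := by linarith
    gcongr
  refine h5.trans ?_
  rw [e3, ey, ex]
  set A := x ^ (1 - α) with hA
  set B := (x + h) ^ (1 - α) with hB
  have hA0 : 0 < A := by positivity
  have hB0 : 0 < B := by positivity
  set v := (1 - α) * (h / (x + h)) with hv
  have hv0 : 0 ≤ v := by
    have : 0 ≤ 1 - α := by linarith
    positivity
  have h6 : A ≤ (1 - v) * B := by rw [hv]; linarith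
  have : (1 - α) * (B⁻¹ / (x + h)) * h = v * B⁻¹ := by rw [hv]; ring
  rw [this, le_sub_iff_add_le]
  have h7 : v * B⁻¹ + B⁻¹ = (1 + v) / B := by ring
  rw [h7, ← one_div, div_le_div_iff₀ hB0 hA0]
  nlinarith [mul_nonneg (sq_nonneg v) hB0.le]

lemma pos_of_volterra (α c : ℝ) (hα : 0 < α) (hα1 : α < 1) (hc : 0 < c) (e : ℝ → ℝ)
    (hcont : Continuous e) (h0 : e 0 = 1) (hd : ∀ t, 0 < t → DifferentiableAt ℝ e t)
    (hV : ∀ t, 0 < t → e t = 1 - c * ∫ s in (0:ℝ)..t, (t - s) ^ (α - 1) * e s) :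
    ∀ t, 0 < t → 0 < e t := by
  intro t1 ht1
  by_contra hneg
  push Not at hneg
  -- the first zero
  have hcomp : IsCompact (Set.Icc 0 t1 ∩ {t | e t ≤ 0}) :=
    isCompact_Icc.inter_right (isClosed_le hcont continuous_const)
  obtain ⟨t0, ⟨ht0m, ht0e⟩, hmin⟩ := hcomp.exists_isLeast ⟨t1, ⟨ht1.le, le_rfl⟩, hneg⟩
  have ht0e' : e t0 ≤ 0 := ht0e
  have ht0 : 0 < t0 := by
    rcases ht0m.1.eq_or_lt with h | h
    · rw [← h, h0] at ht0e'; linarith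
    · exact h
  have hpos : ∀ s, 0 ≤ s → s < t0 → 0 < e s := by
    intro s hs hs'
    by_contra hcon
    push Not at hcon
    have := hmin ⟨⟨hs, by linarith [ht0m.2]⟩, hcon⟩
    linarith
  have hzero : e t0 = 0 := by
    refine le_antisymm ht0e' ?_
    have hcl : IsClosed {t | 0 ≤ e t} := isClosed_le continuous_const hcont
    have hsub : Set.Ico 0 t0 ⊆ {t | 0 ≤ e t} := fun s hs ↦ (hpos s hs.1 hs.2).le
    have := closure_minimal hsub hcl
    rw [closure_Ico ht0.ne] at this
    exact this ⟨ht0.le, le_rfl⟩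
  -- Lipschitz bound
  obtain ⟨L, hL, hLb⟩ := (hd t0 ht0).hasDerivAt.isBigO_sub.exists_pos
  rw [Asymptotics.isBigOWith_iff, Metric.eventually_nhds_iff] at hLb
  obtain ⟨δ, hδ, hLb⟩ := hLb
  have hI0 : 0 < ∫ s in (0:ℝ)..(t0 / 2), e s :=
    intervalIntegral.intervalIntegral_pos_of_pos_on (hcont.intervalIntegrable _ _)
      (fun s hs ↦ hpos s hs.1.le (by linarith [hs.2])) (by linarith)
  set I0 := ∫ s in (0:ℝ)..(t0 / 2), e s with hI0def
  set k := (1 - α) * t0 ^ (α - 2) with hk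
  have hkpos : 0 < k := mul_pos (by linarith) (by positivity)
  have hK : 0 < k * I0 := mul_pos hkpos hI0
  have hev : ∀ᶠ h in 𝓝[>] (0:ℝ), L * (h ^ α / α) < k * I0 := by
    have : Tendsto (fun h : ℝ ↦ L * (h ^ α / α)) (𝓝[>] 0) (𝓝 0) := by
      have h1 : Continuous (fun h : ℝ ↦ L * (h ^ α / α)) := by
        have := Real.continuous_rpow_const hα.le
        fun_prop
      have h2 := h1.tendsto 0
      rw [Real.zero_rpow hα.ne', zero_div, mul_zero] at h2
      exact h2.mono_left nhdsWithin_le_nhds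
    exact this.eventually (gt_mem_nhds hK)
  have hev2 : ∀ᶠ h in 𝓝[>] (0:ℝ), h ∈ Set.Ioo 0 (min δ (t0 / 2)) :=
    Ioo_mem_nhdsGT (lt_min hδ (by linarith))
  obtain ⟨h, hh1, hh2⟩ := (hev.and hev2).exists
  have hh : 0 < h := hh2.1
  have hhδ : h < δ := hh2.2.trans_le (min_le_left _ _)
  have hht : h < t0 / 2 := hh2.2.trans_le (min_le_right _ _)
  have hpt := hpos (t0 - h) (by linarith) (by linarith)
  have hV1 := hV (t0 - h) (by linarith)
  have hV0 := hV t0 ht0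
  rw [hzero, ← intervalIntegral.integral_add_adjacent_intervals
    (kernel_ii α t0 0 (t0 - h) hα hcont) (kernel_ii α t0 (t0 - h) t0 hα hcont)] at hV0
  have hA : ∫ s in (t0 - h)..t0, (t0 - s) ^ (α - 1) * e s ≤ L * h * (h ^ α / α) := by
    have hint : ∫ s in (t0 - h)..t0, (t0 - s) ^ (α - 1) * (L * h) = L * h * (h ^ α / α) := by
      rw [intervalIntegral.integral_mul_const,
        intervalIntegral.integral_comp_sub_left (fun x ↦ x ^ (α - 1)) t0,
        integral_rpow (Or.inl (by linarith))]
      simp [hα.ne']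
      ring
    rw [← hint]
    refine intervalIntegral.integral_mono_on (by linarith) (kernel_ii α t0 _ _ hα hcont)
      (kernel_ii α t0 _ _ hα continuous_const) ?_
    intro s hs
    have hs2 : 0 ≤ t0 - s := by linarith [hs.2]
    have hb := hLb (y := s) (by
      rw [Real.dist_eq, abs_sub_comm, abs_of_nonneg hs2]; linarith [hs.1])
    rw [hzero, sub_zero, Real.norm_eq_abs, Real.norm_eq_abs, abs_sub_comm,
      abs_of_nonneg hs2] at hb
    have : e s ≤ L * h := (le_abs_self _).trans (hb.trans (by
      have := hs.1
      gcongr; linarith))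
    exact mul_le_mul_of_nonneg_left this (Real.rpow_nonneg hs2 _)
  have hB : k * h * I0 ≤ (∫ s in (0:ℝ)..(t0 - h), (t0 - h - s) ^ (α - 1) * e s) -
      ∫ s in (0:ℝ)..(t0 - h), (t0 - s) ^ (α - 1) * e s := by
    rw [← intervalIntegral.integral_sub (kernel_ii α (t0 - h) _ _ hα hcont)
      (kernel_ii α t0 _ _ hα hcont)]
    have h1 : I0 ≤ ∫ s in (0:ℝ)..(t0 - h), e s := by
      rw [← intervalIntegral.integral_add_adjacent_intervals
        (hcont.intervalIntegrable 0 (t0 / 2)) (hcont.intervalIntegrable (t0 / 2) (t0 - h))]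
      have : 0 ≤ ∫ s in (t0 / 2)..(t0 - h), e s :=
        intervalIntegral.integral_nonneg (by linarith)
          (fun s hs ↦ (hpos s (by linarith [hs.1]) (by linarith [hs.2])).le)
      linarith
    calc k * h * I0 ≤ k * h * ∫ s in (0:ℝ)..(t0 - h), e s := by gcongr
      _ = ∫ s in (0:ℝ)..(t0 - h), k * h * e s := by
        rw [intervalIntegral.integral_const_mul]
      _ ≤ _ := by
        refine intervalIntegral.integral_mono_on_of_le_Ioo (by linarith)
          ((hcont.const_mul _).intervalIntegrable _ _)
          ((kernel_ii α (t0 - h) _ _ hα hcont).sub (kernel_ii α t0 _ _ hα hcont)) ?_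
        intro s hs
        have hkd := kernel_diff α (t0 - h - s) h t0 hα hα1 (by linarith [hs.2]) hh
          (by linarith [hs.1])
        rw [show t0 - h - s + h = t0 - s by ring] at hkd
        have hes := hpos s hs.1.le (by linarith [hs.2])
        rw [← sub_mul]
        exact mul_le_mul_of_nonneg_right hkd hes.le
  set P := ∫ s in (0:ℝ)..(t0 - h), (t0 - h - s) ^ (α - 1) * e s
  set Q := ∫ s in (0:ℝ)..(t0 - h), (t0 - s) ^ (α - 1) * e s
  set R := ∫ s in (t0 - h)..t0, (t0 - s) ^ (α - 1) * e s
  have h1 : 0 < c * (Q + R - P) := by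
    have : c * (Q + R - P) = e (t0 - h) := by rw [hV1]; linarith
    rw [this]; exact hpt
  have h2 : 0 < Q + R - P := pos_of_mul_pos_right h1 hc.le
  have h3 : h * (L * (h ^ α / α)) < h * (k * I0) := by gcongr
  nlinarith

lemma ml_bounds (α ν t : ℝ) (hα : 0 < α) (hα1 : α < 1) (hν : 0 < ν) (ht : 0 < t) :
    0 < mittagLeffler α 1 (-ν * t ^ α) ∧ mittagLeffler α 1 (-ν * t ^ α) < 1 := by
  obtain ⟨hS, hD⟩ := ml_hasFP α hα hα1
  have hcp : Continuous (fun s : ℝ ↦ s ^ α) := Real.continuous_rpow_const hα.le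
  have hc : 0 < ν / Real.Gamma α := div_pos hν (Real.Gamma_pos_of_pos hα)
  have hcont : Continuous (fun t : ℝ ↦ mittagLeffler α 1 (-ν * t ^ α)) :=
    hD.continuous.comp (by fun_prop)
  have hml0 : mittagLeffler α 1 (-ν * (0:ℝ) ^ α) = 1 := by
    rw [Real.zero_rpow hα.ne', mul_zero, mittagLeffler, tsum_eq_single 0]
    · simp
    · intro n hn; simp [hn]
  have hpos := pos_of_volterra α (ν / Real.Gamma α) hα hα1 hc
    (fun t ↦ mittagLeffler α 1 (-ν * t ^ α)) hcont hml0
    (fun t ht ↦ (hD _).comp t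
      ((Real.differentiableAt_rpow_const_of_ne α ht.ne').const_mul (-ν)))
    (fun t ht ↦ volterra α ν t hα hα1 hν ht)
  refine ⟨hpos t ht, ?_⟩
  rw [volterra α ν t hα hα1 hν ht]
  have : 0 < ∫ s in (0:ℝ)..t, (t - s) ^ (α - 1) * mittagLeffler α 1 (-ν * s ^ α) :=
    intervalIntegral.intervalIntegral_pos_of_pos_on (kernel_ii α t 0 t hα hcont)
      (fun s hs ↦ mul_pos (Real.rpow_pos_of_pos (by linarith [hs.2]) _) (hpos s hs.1)) ht
  have := mul_pos hc this
  linarith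

end helpers

/-- Let `0 < α < 1`, `λ > 0`, `μ > 0`, `T > 0`, `φ, ψ ∈ ℝ`, `ν = μ/(1+λ)`.
There exists a unique pair `(C, f)` such that `u(t) = f/μ + C E_{α,1}(−ν t^α)`
satisfies `u(0) = φ` and `u(T) = ψ`; namely
`C = (φ − ψ)/(1 − E_{α,1}(−ν T^α))` and `f = μφ − μC`
(the denominator is nonzero since `0 < E_{α,1}(−ν T^α) < 1`). -/
theorem unique_pair_inverse_ode (α lam μ T φ ψ : ℝ) (hα : 0 < α) (hα1 : α < 1)
    (hlam : 0 < lam) (hμ : 0 < μ) (hT : 0 < T) :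
    (0 < mittagLeffler α 1 (-(μ / (1 + lam)) * T ^ α) ∧
      mittagLeffler α 1 (-(μ / (1 + lam)) * T ^ α) < 1) ∧
    (∃! p : ℝ × ℝ,
      p.2 / μ + p.1 * mittagLeffler α 1 (-(μ / (1 + lam)) * (0:ℝ) ^ α) = φ ∧
      p.2 / μ + p.1 * mittagLeffler α 1 (-(μ / (1 + lam)) * T ^ α) = ψ) ∧
    ∀ p : ℝ × ℝ,
      (p.2 / μ + p.1 * mittagLeffler α 1 (-(μ / (1 + lam)) * (0:ℝ) ^ α) = φ ∧
        p.2 / μ + p.1 * mittagLeffler α 1 (-(μ / (1 + lam)) * T ^ α) = ψ) →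
      p.1 = (φ - ψ) / (1 - mittagLeffler α 1 (-(μ / (1 + lam)) * T ^ α)) ∧
        p.2 = μ * φ - μ * p.1 := by
  have hν : 0 < μ / (1 + lam) := by positivity
  have hb := ml_bounds α (μ / (1 + lam)) T hα hα1 hν hT
  have hml0 : mittagLeffler α 1 (-(μ / (1 + lam)) * (0:ℝ) ^ α) = 1 := by
    rw [Real.zero_rpow hα.ne', mul_zero, mittagLeffler, tsum_eq_single 0]
    · simp
    · intro n hn; simp [hn]
  rw [hml0]
  set E := mittagLeffler α 1 (-(μ / (1 + lam)) * T ^ α)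
  have hE : 1 - E ≠ 0 := by linarith [hb.2]
  have huniq : ∀ p : ℝ × ℝ, (p.2 / μ + p.1 * 1 = φ ∧ p.2 / μ + p.1 * E = ψ) →
      p.1 = (φ - ψ) / (1 - E) ∧ p.2 = μ * φ - μ * p.1 := by
    rintro ⟨C, f⟩ ⟨h1, h2⟩
    simp only at h1 h2 ⊢
    constructor
    · rw [eq_div_iff hE]; linarith
    · rw [← h1]; field_simp; ring
  refine ⟨hb, ⟨((φ - ψ) / (1 - E), μ * φ - μ * ((φ - ψ) / (1 - E))), ⟨?_, ?_⟩, ?_⟩, huniq⟩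
  · simp only
    field_simp
    ring
  · simp only
    field_simp
    ring
  · intro p hp
    obtain ⟨h1, h2⟩ := huniq p hp
    ext
    · exact h1
    · simp only; rw [h2, h1]
end
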